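/- arXiv:1502.00203 — 3 statements merged into one kernel-verified Lean document; each statement's English description precedes it below -/
import Mathlib

section
/- The polynomial f₆ is a nonzero skew-invariant for the Σ₅-action permuting index positions: for every σ ∈ Σ₅, σ·f₆ = sgn(σ)·f₆, and f₆ ≠ 0. -/
open MvPolynomial

noncomputable section

/-- A 2×2×2×2×2 tensor `p` has rank at most `r`. -/
def HasRankLE (k : Type*) [Field k] (r : ℕ) (p : (Fin 5 → Fin 2) → k) : Prop :=
  ∃ a : Fin r → Fin 5 → Fin 2 → k,
    ∀ I : Fin 5 → Fin 2, p I = ∑ j : Fin r, ∏ i : Fin 5, a j i (I i)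

/-- The ideal of polynomials vanishing on all tensors of rank at most 5. -/
def vanishingIdealX (k : Type*) [Field k] : Ideal (MvPolynomial (Fin 5 → Fin 2) k) where
  carrier := {f | ∀ p : (Fin 5 → Fin 2) → k, HasRankLE k 5 p → MvPolynomial.eval p f = 0}
  add_mem' := by
    intro f g hf hg p hp
    simp [map_add, hf p hp, hg p hp]
  zero_mem' := by intro p hp; simp
  smul_mem' := by
    intro c f hf p hp
    simp [smul_eq_mul, map_mul, hf p hp]

/-- The action of `Σ₅` on the polynomial ring, permuting the index positions:
`σ · x_I = x_{I ∘ σ⁻¹}`. -/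
def permAct (k : Type*) [Field k] (σ : Equiv.Perm (Fin 5))
    (f : MvPolynomial (Fin 5 → Fin 2) k) : MvPolynomial (Fin 5 → Fin 2) k :=
  MvPolynomial.rename (fun I : Fin 5 → Fin 2 => I ∘ ⇑σ⁻¹) f

/-- The variable `x_I` for `I = (a,b,c,d,e)`. -/
def XV (k : Type*) [Field k] (a b c d e : Fin 2) : MvPolynomial (Fin 5 → Fin 2) k :=
  MvPolynomial.X ![a, b, c, d, e]

/-- The distinguished degree-6 monomial combination `M`. -/
def M6 (k : Type*) [Field k] : MvPolynomial (Fin 5 → Fin 2) k :=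
  -(XV k 0 0 0 0 0 * XV k 0 1 0 1 0 * XV k 0 1 1 0 1 * XV k 1 0 0 1 1 * XV k 1 0 1 0 0 * XV k 1 1 1 1 1)
  + XV k 0 0 0 0 0 * XV k 0 1 1 0 0 * XV k 0 1 1 1 1 * XV k 1 0 0 1 0 * XV k 1 0 1 1 1 * XV k 1 1 0 0 1
  - XV k 0 0 0 0 0 * XV k 0 1 1 0 0 * XV k 0 1 1 1 1 * XV k 1 0 0 1 1 * XV k 1 0 1 1 0 * XV k 1 1 0 0 1
  + XV k 0 0 0 0 0 * XV k 0 1 1 0 1 * XV k 0 1 1 1 0 * XV k 1 0 0 1 1 * XV k 1 0 1 1 0 * XV k 1 1 0 0 1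
  - XV k 0 0 1 1 0 * XV k 0 1 0 0 0 * XV k 0 1 1 0 1 * XV k 1 0 0 0 0 * XV k 1 0 0 1 1 * XV k 1 1 1 1 1
  + XV k 0 0 1 0 0 * XV k 0 1 0 1 0 * XV k 0 1 1 1 1 * XV k 1 0 0 0 0 * XV k 1 0 1 1 1 * XV k 1 1 0 0 1
  + XV k 0 0 1 0 0 * XV k 0 1 0 0 0 * XV k 0 1 1 1 1 * XV k 1 0 0 1 1 * XV k 1 0 1 1 0 * XV k 1 1 0 0 1
  + XV k 0 0 1 1 0 * XV k 0 1 0 0 0 * XV k 0 1 1 0 1 * XV k 1 0 0 0 1 * XV k 1 0 0 1 0 * XV k 1 1 1 1 1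
  - XV k 0 0 1 0 0 * XV k 0 1 0 1 0 * XV k 0 1 1 1 1 * XV k 1 0 0 0 1 * XV k 1 0 1 1 1 * XV k 1 1 0 0 0
  + XV k 0 0 1 0 0 * XV k 0 1 0 1 0 * XV k 0 1 1 1 1 * XV k 1 0 0 1 1 * XV k 1 0 1 0 1 * XV k 1 1 0 0 0
  - XV k 0 0 1 0 1 * XV k 0 1 0 1 0 * XV k 0 1 1 1 1 * XV k 1 0 0 0 0 * XV k 1 0 1 1 0 * XV k 1 1 0 0 1
  + XV k 0 0 1 0 0 * XV k 0 1 0 1 1 * XV k 0 1 1 1 0 * XV k 1 0 0 1 1 * XV k 1 0 1 0 1 * XV k 1 1 0 0 0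
  - XV k 0 0 1 1 0 * XV k 0 1 0 0 1 * XV k 0 1 1 0 0 * XV k 1 0 0 0 1 * XV k 1 0 0 1 0 * XV k 1 1 1 1 1
  + XV k 0 0 1 1 0 * XV k 0 1 0 0 1 * XV k 0 1 1 1 1 * XV k 1 0 0 1 1 * XV k 1 0 1 0 0 * XV k 1 1 0 0 0
  + XV k 0 0 1 1 1 * XV k 0 1 0 1 0 * XV k 0 1 1 0 1 * XV k 1 0 0 1 1 * XV k 1 0 1 0 0 * XV k 1 1 0 0 0

/-- The degree-6 skew-invariant `f₆ = Σ_{σ ∈ Σ₅} sgn(σ) · (σ · M)`. -/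
def f6 (k : Type*) [Field k] : MvPolynomial (Fin 5 → Fin 2) k :=
  ∑ σ : Equiv.Perm (Fin 5), (Equiv.Perm.sign σ : ℤ) • permAct k σ (M6 k)

/-- The action of `SL₂(k)^{×5}` on tensors. -/
def actSL (k : Type*) [Field k] (g : Fin 5 → Matrix.SpecialLinearGroup (Fin 2) k)
    (p : (Fin 5 → Fin 2) → k) : (Fin 5 → Fin 2) → k :=
  fun I => ∑ J : Fin 5 → Fin 2,
    (∏ i : Fin 5, ((g i : Matrix (Fin 2) (Fin 2) k) (I i) (J i))) * p J

end

/-- The indicator function of the support of the first monomial of `M6`. -/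
def f6Witness (I : Fin 5 → Fin 2) : ℤ :=
  if I ∈ [![0, 0, 0, 0, 0], ![0, 1, 0, 1, 0], ![0, 1, 1, 0, 1], ![1, 0, 0, 1, 1],
    ![1, 0, 1, 0, 0], ![1, 1, 1, 1, 1]] then 1 else 0

lemma permAct_mul (k : Type*) [Field k] (σ τ : Equiv.Perm (Fin 5))
    (f : MvPolynomial (Fin 5 → Fin 2) k) :
    permAct k σ (permAct k τ f) = permAct k (σ * τ) f := by
  simp only [permAct, rename_rename, mul_inv_rev]
  rfl

lemma permAct_f6 (k : Type*) [Field k] (σ : Equiv.Perm (Fin 5)) :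
    permAct k σ (f6 k) = (Equiv.Perm.sign σ : ℤ) • f6 k := by
  have h : permAct k σ (f6 k) =
      ∑ τ : Equiv.Perm (Fin 5), (Equiv.Perm.sign τ : ℤ) • permAct k (σ * τ) (M6 k) := by
    simp only [← permAct_mul]
    simp only [f6, permAct, map_sum, map_zsmul]
  rw [h, f6, Finset.smul_sum]
  refine Fintype.sum_equiv (Equiv.mulLeft σ) _ _ fun τ => ?_
  rw [smul_smul, Equiv.coe_mulLeft, map_mul, Units.val_mul, ← mul_assoc,
    ← Units.val_mul, Int.units_mul_self, Units.val_one, one_mul]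

/-- The value of `M6` at an integral point. -/
def evalM6 (p : (Fin 5 → Fin 2) → ℤ) : ℤ :=
  -(p ![0, 0, 0, 0, 0] * p ![0, 1, 0, 1, 0] * p ![0, 1, 1, 0, 1] * p ![1, 0, 0, 1, 1] *
      p ![1, 0, 1, 0, 0] * p ![1, 1, 1, 1, 1])
  + p ![0, 0, 0, 0, 0] * p ![0, 1, 1, 0, 0] * p ![0, 1, 1, 1, 1] * p ![1, 0, 0, 1, 0] *
      p ![1, 0, 1, 1, 1] * p ![1, 1, 0, 0, 1]
  - p ![0, 0, 0, 0, 0] * p ![0, 1, 1, 0, 0] * p ![0, 1, 1, 1, 1] * p ![1, 0, 0, 1, 1] *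
      p ![1, 0, 1, 1, 0] * p ![1, 1, 0, 0, 1]
  + p ![0, 0, 0, 0, 0] * p ![0, 1, 1, 0, 1] * p ![0, 1, 1, 1, 0] * p ![1, 0, 0, 1, 1] *
      p ![1, 0, 1, 1, 0] * p ![1, 1, 0, 0, 1]
  - p ![0, 0, 1, 1, 0] * p ![0, 1, 0, 0, 0] * p ![0, 1, 1, 0, 1] * p ![1, 0, 0, 0, 0] *
      p ![1, 0, 0, 1, 1] * p ![1, 1, 1, 1, 1]
  + p ![0, 0, 1, 0, 0] * p ![0, 1, 0, 1, 0] * p ![0, 1, 1, 1, 1] * p ![1, 0, 0, 0, 0] *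
      p ![1, 0, 1, 1, 1] * p ![1, 1, 0, 0, 1]
  + p ![0, 0, 1, 0, 0] * p ![0, 1, 0, 0, 0] * p ![0, 1, 1, 1, 1] * p ![1, 0, 0, 1, 1] *
      p ![1, 0, 1, 1, 0] * p ![1, 1, 0, 0, 1]
  + p ![0, 0, 1, 1, 0] * p ![0, 1, 0, 0, 0] * p ![0, 1, 1, 0, 1] * p ![1, 0, 0, 0, 1] *
      p ![1, 0, 0, 1, 0] * p ![1, 1, 1, 1, 1]
  - p ![0, 0, 1, 0, 0] * p ![0, 1, 0, 1, 0] * p ![0, 1, 1, 1, 1] * p ![1, 0, 0, 0, 1] *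
      p ![1, 0, 1, 1, 1] * p ![1, 1, 0, 0, 0]
  + p ![0, 0, 1, 0, 0] * p ![0, 1, 0, 1, 0] * p ![0, 1, 1, 1, 1] * p ![1, 0, 0, 1, 1] *
      p ![1, 0, 1, 0, 1] * p ![1, 1, 0, 0, 0]
  - p ![0, 0, 1, 0, 1] * p ![0, 1, 0, 1, 0] * p ![0, 1, 1, 1, 1] * p ![1, 0, 0, 0, 0] *
      p ![1, 0, 1, 1, 0] * p ![1, 1, 0, 0, 1]
  + p ![0, 0, 1, 0, 0] * p ![0, 1, 0, 1, 1] * p ![0, 1, 1, 1, 0] * p ![1, 0, 0, 1, 1] *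
      p ![1, 0, 1, 0, 1] * p ![1, 1, 0, 0, 0]
  - p ![0, 0, 1, 1, 0] * p ![0, 1, 0, 0, 1] * p ![0, 1, 1, 0, 0] * p ![1, 0, 0, 0, 1] *
      p ![1, 0, 0, 1, 0] * p ![1, 1, 1, 1, 1]
  + p ![0, 0, 1, 1, 0] * p ![0, 1, 0, 0, 1] * p ![0, 1, 1, 1, 1] * p ![1, 0, 0, 1, 1] *
      p ![1, 0, 1, 0, 0] * p ![1, 1, 0, 0, 0]
  + p ![0, 0, 1, 1, 1] * p ![0, 1, 0, 1, 0] * p ![0, 1, 1, 0, 1] * p ![1, 0, 0, 1, 1] *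
      p ![1, 0, 1, 0, 0] * p ![1, 1, 0, 0, 0]

lemma eval_permAct_M6 (k : Type*) [Field k] (σ : Equiv.Perm (Fin 5))
    (p : (Fin 5 → Fin 2) → ℤ) :
    eval (fun I => (p I : k)) (permAct k σ (M6 k)) =
      (evalM6 fun I => p (I ∘ ⇑σ⁻¹) : ℤ) := by
  simp only [permAct, eval_rename, M6, XV, evalM6, map_add, map_sub, map_neg, map_mul, eval_X,
    Function.comp_def]
  push_cast
  rfl

lemma sum_sign_mul_evalM6_witness :
    ∑ σ : Equiv.Perm (Fin 5),
      (Equiv.Perm.sign σ : ℤ) * evalM6 (fun I => f6Witness (I ∘ ⇑σ⁻¹)) ≠ 0 := by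
  decide +kernel

theorem f6_skew_invariant_and_ne_zero (k : Type*) [Field k] [IsAlgClosed k] [CharZero k] :
    (∀ σ : Equiv.Perm (Fin 5),
      permAct k σ (f6 k) = (Equiv.Perm.sign σ : ℤ) • f6 k) ∧ f6 k ≠ 0 := by
  refine ⟨permAct_f6 k, fun h => sum_sign_mul_evalM6_witness ?_⟩
  apply Int.cast_injective (α := k)
  rw [Int.cast_sum, Int.cast_zero, ← map_zero (eval fun I => (f6Witness I : k)), ← h, f6, map_sum]
  refine Finset.sum_congr rfl fun σ _ => ?_
  rw [map_zsmul, eval_permAct_M6, zsmul_eq_mul, Int.cast_mul]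
end

section
/- The Krull dimension of the quotient ring R/I(X) equals 30; equivalently, the affine cone X over the fifth secant variety of (P¹)^{×5} has codimension 2 in k^{32}. -/
open MvPolynomial

/-- An injective integral extension of commutative rings preserves the Krull dimension. -/
theorem ringKrullDim_eq_of_isIntegral_of_injective (R S : Type*) [CommRing R] [CommRing S]
    [Algebra R S] [Algebra.IsIntegral R S] (hinj : Function.Injective (algebraMap R S)) :
    ringKrullDim S = ringKrullDim R := by
  apply le_antisymm
  · refine Order.krullDim_le_of_strictMono (PrimeSpectrum.comap (algebraMap R S)) fun P Q h ↦ ?_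
    exact Ideal.IsIntegral.comap_lt_comap (R := R) h
  · refine iSup_le fun l ↦ ?_
    obtain ⟨P, -, hP, hPl⟩ := Ideal.exists_ideal_over_prime_of_isIntegral l.head.asIdeal (⊥ : Ideal S)
      (by
        rw [← RingHom.ker_eq_comap_bot, (RingHom.injective_iff_ker_eq_bot _).mp hinj]
        exact bot_le)
    have : P.LiesOver l.head.asIdeal := ⟨hPl.symm⟩
    obtain ⟨L, hL, -⟩ := Ideal.exists_ltSeries_of_hasGoingUp l P
    rw [← hL]
    exact Order.LTSeries.length_le_krullDim L

/-- The Krull dimension of a finitely generated domain over a field is its transcendence degree. -/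
theorem ringKrullDim_eq_of_trdeg_eq (k A : Type*) [Field k] [CommRing A] [IsDomain A]
    [Algebra k A] [Algebra.FiniteType k A] {n : ℕ} (hn : Algebra.trdeg k A = n) :
    ringKrullDim A = n := by
  obtain ⟨s, g, hg, hint⟩ := exists_integral_inj_algHom_of_fg k A
  algebraize [g.toRingHom]
  have : Algebra.IsIntegral (MvPolynomial (Fin s) k) A := ⟨hint⟩
  have : FaithfulSMul (MvPolynomial (Fin s) k) A :=
    (faithfulSMul_iff_algebraMap_injective _ _).mpr hg
  have : IsScalarTower k (MvPolynomial (Fin s) k) A :=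
    IsScalarTower.of_algebraMap_eq fun x ↦ (g.commutes x).symm
  have hs := lift_trdeg_add_eq k (MvPolynomial (Fin s) k) A
  rw [MvPolynomial.trdeg_of_isDomain, hn,
    trdeg_eq_zero_iff.mpr (inferInstance : Algebra.IsAlgebraic (MvPolynomial (Fin s) k) A)] at hs
  have hsn : s = n := by
    simpa using hs
  rw [ringKrullDim_eq_of_isIntegral_of_injective (MvPolynomial (Fin s) k) A hg,
    MvPolynomial.ringKrullDim_of_isNoetherianRing, ringKrullDim_eq_zero_of_field, hsn]
  simp

namespace MvPolynomial

/-- The chain rule for partial derivatives of a polynomial evaluated at polynomials. -/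
theorem pderiv_aeval {k ι σ : Type*} [CommRing k] [Fintype ι] (f : ι → MvPolynomial σ k) (j : σ)
    (P : MvPolynomial ι k) :
    pderiv j (aeval f P) = ∑ i, aeval f (pderiv i P) * pderiv j (f i) := by
  classical
  induction P using MvPolynomial.induction_on with
  | C a => simp
  | add p q hp hq => simp only [map_add, hp, hq, add_mul, Finset.sum_add_distrib]
  | mul_X p i hp =>
    simp only [map_mul, aeval_X, pderiv_mul, hp, pderiv_X, map_add, add_mul,
      Finset.sum_add_distrib, Finset.sum_mul]
    congr 1
    · exact Finset.sum_congr rfl fun _ _ ↦ by ring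
    · rw [Finset.sum_eq_single i (fun l _ hl ↦ by simp [hl.symm]) (by simp)]
      simp

theorem totalDegree_pderiv_le {k σ : Type*} [CommRing k] {n : ℕ} (i : σ) (P : MvPolynomial σ k)
    (hP : P.totalDegree ≤ n + 1) : (pderiv i P).totalDegree ≤ n := by
  refine Finset.sup_le fun m hm ↦ ?_
  rw [mem_support_iff, coeff_pderiv] at hm
  have h := le_totalDegree (mem_support_iff.mpr (left_ne_zero_of_mul hm))
  rw [Finsupp.sum_add_index' (by simp) (by simp), Finsupp.sum_single_index rfl] at h
  lia

theorem totalDegree_eq_zero_of_forall_pderiv_eq_zero {k σ : Type*} [Field k] [CharZero k]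
    (P : MvPolynomial σ k) (hP : ∀ i, pderiv i P = 0) : P.totalDegree = 0 := by
  refine (totalDegree_eq_zero_iff _ P).mpr fun m hm i ↦ ?_
  by_contra hi
  have hle : Finsupp.single i 1 ≤ m := by
    simpa [Finsupp.single_le_iff] using Nat.one_le_iff_ne_zero.mpr hi
  have h := congrArg (coeff (m - Finsupp.single i 1)) (hP i)
  rw [coeff_pderiv, tsub_add_cancel_of_le hle, coeff_zero] at h
  rcases mul_eq_zero.mp h with h | h
  · exact mem_support_iff.mp hm h
  · exact Nat.cast_add_one_ne_zero _ h

/-- The Jacobian criterion for algebraic independence: it suffices that some square submatrix of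
the Jacobian matrix is nonsingular at some point. -/
theorem algebraicIndependent_of_det_pderiv_ne_zero {k ι σ : Type*} [Field k] [CharZero k]
    [Fintype ι] [DecidableEq ι] (f : ι → MvPolynomial σ k) (v : ι → σ) (x : σ → k)
    (h : (Matrix.of fun i j ↦ eval x (pderiv (v j) (f i))).det ≠ 0) :
    AlgebraicIndependent k f := by
  have hdet : (Matrix.of fun i j ↦ pderiv (v j) (f i)).det ≠ 0 := by
    intro h0
    apply h
    have := congrArg (eval x) h0
    rwa [RingHom.map_det, map_zero] at this
  rw [algebraicIndependent_iff]
  suffices ∀ (n : ℕ) (P : MvPolynomial ι k), P.totalDegree ≤ n → aeval f P = 0 → P = 0 from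
    fun P ↦ this _ P le_rfl
  have hconst (P : MvPolynomial ι k) (hP : P.totalDegree = 0) (h0 : aeval f P = 0) : P = 0 := by
    rw [totalDegree_eq_zero_iff_eq_C] at hP
    rw [hP, aeval_C, algebraMap_eq, C_eq_zero] at h0
    rw [hP, h0, C_0]
  intro n
  induction n with
  | zero => exact fun P hP ↦ hconst P (Nat.le_zero.mp hP)
  | succ n ih =>
    intro P hP h0
    refine hconst P (totalDegree_eq_zero_of_forall_pderiv_eq_zero P fun i ↦ ?_) h0
    refine ih _ (totalDegree_pderiv_le i P hP) ?_
    refine congrFun (Matrix.eq_zero_of_vecMul_eq_zero hdet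
      (v := fun i ↦ aeval f (pderiv i P)) ?_) i
    ext1 j
    have := pderiv_aeval f (v j) P
    rw [h0, map_zero] at this
    exact this.symm

end MvPolynomial

/-- The coordinate `x_I` of a sum of five rank-one tensors, whose factors are indeterminates. -/
noncomputable def secantCoord (k : Type*) [Field k] (I : Fin 5 → Fin 2) :
    MvPolynomial (Fin 5 × Fin 5 × Fin 2) k :=
  ∑ j, ∏ i, X (j, i, I i)

/-- The factors of five rank-one tensors, normalized so that all factors but the first one have
leading coordinate `1`. -/
noncomputable def normalizedFactor (k : Type*) [Field k] (j i : Fin 5) (b : Fin 2) :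
    MvPolynomial (Fin 5 × Option (Fin 5)) k :=
  if b = 0 then (if i = 0 then X (j, none) else 1) else X (j, some i)

/-- The coordinate `x_I` of a sum of five rank-one tensors with normalized factors. -/
noncomputable def normalizedSecantCoord (k : Type*) [Field k] (I : Fin 5 → Fin 2) :
    MvPolynomial (Fin 5 × Option (Fin 5)) k :=
  ∑ j, ∏ i, normalizedFactor k j i (I i)

theorem eval_secantCoord {k : Type*} [Field k] (x : Fin 5 × Fin 5 × Fin 2 → k)
    (I : Fin 5 → Fin 2) : eval x (secantCoord k I) = ∑ j, ∏ i, x (j, i, I i) := by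
  simp [secantCoord]

theorem eval_aeval_eq {k ι σ : Type*} [Field k] (c : ι → MvPolynomial σ k) (x : σ → k)
    (f : MvPolynomial ι k) : eval x (aeval c f) = eval (fun i ↦ eval x (c i)) f := by
  rw [← coe_aeval_eq_eval, ← coe_aeval_eq_eval, RingHom.coe_coe, RingHom.coe_coe,
    ← AlgHom.comp_apply, comp_aeval]

theorem mem_vanishingIdealX_iff {k : Type*} [Field k] [Infinite k]
    (f : MvPolynomial (Fin 5 → Fin 2) k) :
    f ∈ vanishingIdealX k ↔ aeval (secantCoord k) f = 0 := by
  constructor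
  · intro hf
    refine MvPolynomial.funext fun x ↦ ?_
    rw [eval_aeval_eq, map_zero]
    exact hf _ ⟨fun j i b ↦ x (j, i, b), eval_secantCoord x⟩
  · rintro hf p ⟨a, ha⟩
    have h := eval_aeval_eq (secantCoord k) (fun v ↦ a v.1 v.2.1 v.2.2) f
    rw [hf, map_zero] at h
    rw [h]
    simp_rw [eval_secantCoord, ← ha]

theorem exists_eval_normalizedSecantCoord {k : Type*} [Field k] (x : Fin 5 × Fin 5 × Fin 2 → k)
    (hx : ∀ v, x v ≠ 0) :
    ∃ y, ∀ I, eval y (normalizedSecantCoord k I) = eval x (secantCoord k I) := by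
  let y : Fin 5 × Option (Fin 5) → k := fun v ↦
    let s := ∏ i, x (v.1, i, 0)
    v.2.elim s fun i ↦
      (if i = 0 then s / x (v.1, 0, 0) else (x (v.1, i, 0))⁻¹) * x (v.1, i, 1)
  have hy (j i : Fin 5) (b : Fin 2) : eval y (normalizedFactor k j i b) =
      (if i = 0 then ∏ l, x (j, l, 0) else 1) / x (j, i, 0) * x (j, i, b) := by
    have := hx (j, i, 0)
    by_cases hi : i = 0
    · subst hi
      fin_cases b <;> simp [normalizedFactor, y, this]
    · fin_cases b <;> simp [normalizedFactor, y, hi, this]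
  refine ⟨y, fun I ↦ ?_⟩
  simp only [eval_secantCoord, normalizedSecantCoord, map_sum, map_prod, hy]
  refine Finset.sum_congr rfl fun j _ ↦ ?_
  rw [Finset.prod_mul_distrib, Finset.prod_div_distrib, Finset.prod_ite_eq' Finset.univ,
    if_pos (Finset.mem_univ _), div_self (Finset.prod_ne_zero_iff.mpr fun i _ ↦ hx _), one_mul]

theorem mem_vanishingIdealX_iff_normalized {k : Type*} [Field k] [Infinite k]
    (f : MvPolynomial (Fin 5 → Fin 2) k) :
    f ∈ vanishingIdealX k ↔ aeval (normalizedSecantCoord k) f = 0 := by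
  constructor
  · intro hf
    refine MvPolynomial.funext fun y ↦ ?_
    rw [eval_aeval_eq, map_zero]
    refine hf _ ⟨fun j i b ↦ eval y (normalizedFactor k j i b), fun I ↦ ?_⟩
    simp [normalizedSecantCoord]
  · intro hf
    rw [mem_vanishingIdealX_iff]
    refine MvPolynomial.funext_set (fun _ ↦ {0}ᶜ) (fun _ ↦ (Set.finite_singleton 0).infinite_compl)
      fun x hx ↦ ?_
    obtain ⟨y, hy⟩ := exists_eval_normalizedSecantCoord x fun v ↦ hx v trivial
    have h := eval_aeval_eq (normalizedSecantCoord k) y f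
    rw [hf, map_zero] at h
    rw [eval_aeval_eq, map_zero, h]
    simp_rw [hy]

theorem Derivation.map_prod_eq_zero {R A M ι : Type*} [CommSemiring R] [CommSemiring A]
    [AddCommMonoid M] [Algebra R A] [Module A M] [Module R M] (D : Derivation R A M)
    {s : Finset ι} {f : ι → A} (h : ∀ i ∈ s, D (f i) = 0) : D (∏ i ∈ s, f i) = 0 := by
  refine Finset.prod_induction f (fun a ↦ D a = 0) (fun a b ha hb ↦ ?_) D.map_one_eq_zero h
  rw [D.leibniz, ha, hb, smul_zero, smul_zero, add_zero]

theorem eval_pderiv_secantCoord {k : Type*} [Field k] (x : Fin 5 × Fin 5 × Fin 2 → k)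
    (v : Fin 5 × Fin 5 × Fin 2) (I : Fin 5 → Fin 2) :
    eval x (pderiv v (secantCoord k I)) =
      if I v.2.1 = v.2.2 then ∏ i ∈ Finset.univ.erase v.2.1, x (v.1, i, I i) else 0 := by
  obtain ⟨j, i, b⟩ := v
  have hprod (l : Fin 5) : eval x (pderiv (j, i, b) (∏ m, X (l, m, I m) : MvPolynomial _ k)) =
      if l = j then if I i = b then ∏ m ∈ Finset.univ.erase i, x (j, m, I m) else 0 else 0 := by
    have hrest : pderiv (j, i, b) (∏ m ∈ Finset.univ.erase i, X (l, m, I m) :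
        MvPolynomial _ k) = 0 := by
      refine Derivation.map_prod_eq_zero _ fun m hm ↦ pderiv_X_of_ne fun h ↦ ?_
      simp only [Prod.mk.injEq] at h
      exact Finset.ne_of_mem_erase hm h.2.1
    rw [← Finset.mul_prod_erase _ _ (Finset.mem_univ i), pderiv_mul, hrest, pderiv_X]
    by_cases hl : l = j
    · subst hl
      by_cases hb : I i = b
      · subst hb
        simp
      · simp [hb]
    · simp [hl]
  simp [secantCoord, hprod]

/-- Five pairs of the form `(1, 0)`, `(0, 1)` or `(1, 1)` in each of the five tensor factors. -/
def sparsePoint (v : Fin 5 × Fin 5 × Fin 2) : ℕ :=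
  let t : Fin 5 → Fin 5 → ℕ :=
    ![![1, 1, 1, 0, 2], ![0, 1, 0, 2, 2], ![1, 2, 2, 1, 1], ![2, 0, 0, 2, 1], ![0, 0, 1, 1, 0]]
  if t v.1 v.2.1 = v.2.2 ∨ t v.1 v.2.1 = 2 then 1 else 0

/-- Thirty of the tensor coordinates, encoded by the binary digits of a number below `32`. -/
def selectedCoord (n : Fin 30) (i : Fin 5) : Fin 2 :=
  let c : Fin 30 → ℕ :=
    ![22, 7, 23, 18, 10, 26, 12, 13, 14, 30, 8, 4, 28, 24, 16, 0, 17, 25, 29, 27, 31, 15, 19, 3, 11,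
      21, 5, 9, 20, 1]
  if (c n).testBit i then 1 else 0

/-- Thirty of the parameters of five rank-one tensors, ordered compatibly with
`selectedCoord`. -/
def selectedParam : Fin 30 → Fin 5 × Fin 5 × Fin 2 :=
  ![(0, 0, 0), (0, 4, 0), (0, 0, 1), (1, 3, 0), (1, 4, 0), (1, 0, 0), (4, 0, 0), (4, 0, 1),
    (4, 1, 1), (1, 2, 1), (4, 2, 0), (4, 3, 0), (4, 4, 1), (2, 0, 0), (3, 0, 0), (1, 1, 0),
    (3, 3, 0), (3, 0, 1), (2, 1, 0), (2, 2, 0), (2, 0, 1), (0, 3, 1), (3, 1, 1), (0, 2, 0),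
    (1, 0, 1), (2, 3, 0), (0, 1, 0), (2, 4, 0), (3, 2, 1), (3, 4, 0)]

/-- The entries of the Jacobian matrix of `secantCoord` at `sparsePoint`. -/
def sparseJacobian (m n : Fin 30) : ℕ :=
  if selectedCoord m (selectedParam n).2.1 = (selectedParam n).2.2 then
    ∏ i ∈ Finset.univ.erase (selectedParam n).2.1,
      sparsePoint ((selectedParam n).1, i, selectedCoord m i)
  else 0

theorem sparseJacobian_eq_zero : ∀ m n, n < m → sparseJacobian m n = 0 := by
  decide +kernel

theorem sparseJacobian_self : ∀ n, sparseJacobian n n = 1 := by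
  decide +kernel

theorem algebraicIndependent_secantCoord (k : Type*) [Field k] [CharZero k] :
    AlgebraicIndependent k fun n ↦ secantCoord k (selectedCoord n) := by
  refine algebraicIndependent_of_det_pderiv_ne_zero _ selectedParam (fun v ↦ sparsePoint v) ?_
  have hJ : (Matrix.of fun m n ↦ eval (fun v ↦ (sparsePoint v : k))
      (pderiv (selectedParam n) (secantCoord k (selectedCoord m)))) =
      Matrix.of fun m n ↦ (sparseJacobian m n : k) := by
    ext m n
    simp [eval_pderiv_secantCoord, sparseJacobian]
  rw [hJ, Matrix.det_of_isUpperTriangular]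
  · simp [sparseJacobian_self]
  · intro m n hmn
    simp [sparseJacobian_eq_zero m n hmn]

theorem trdeg_quotient_vanishingIdealX (k : Type*) [Field k] [CharZero k] :
    Algebra.trdeg k (MvPolynomial (Fin 5 → Fin 2) k ⧸ vanishingIdealX k) = 30 := by
  apply le_antisymm
  · let φ : (MvPolynomial (Fin 5 → Fin 2) k ⧸ vanishingIdealX k) →ₐ[k]
        MvPolynomial (Fin 5 × Option (Fin 5)) k :=
      Ideal.Quotient.liftₐ _ (aeval (normalizedSecantCoord k))
        fun f hf ↦ (mem_vanishingIdealX_iff_normalized f).mp hf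
    have hφ : Function.Injective φ := by
      refine (injective_iff_map_eq_zero φ).mpr fun a ha ↦ ?_
      obtain ⟨f, rfl⟩ := Ideal.Quotient.mk_surjective a
      exact Ideal.Quotient.eq_zero_iff_mem.mpr ((mem_vanishingIdealX_iff_normalized f).mpr ha)
    simpa using trdeg_le_of_injective φ hφ
  · let ψ : (MvPolynomial (Fin 5 → Fin 2) k ⧸ vanishingIdealX k) →ₐ[k]
        MvPolynomial (Fin 5 × Fin 5 × Fin 2) k :=
      Ideal.Quotient.liftₐ _ (aeval (secantCoord k))
        fun f hf ↦ (mem_vanishingIdealX_iff f).mp hf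
    have h : AlgebraicIndependent k fun n ↦ Ideal.Quotient.mk (vanishingIdealX k)
        (X (selectedCoord n)) := by
      refine AlgebraicIndependent.of_comp ψ ?_
      convert algebraicIndependent_secantCoord k with n
      exact aeval_X _ _
    simpa using h.lift_cardinalMk_le_trdeg

theorem isPrime_vanishingIdealX (k : Type*) [Field k] [Infinite k] :
    (vanishingIdealX k).IsPrime := by
  have : vanishingIdealX k = RingHom.ker (aeval (R := k) (secantCoord k)) := by
    ext f
    exact mem_vanishingIdealX_iff f
  rw [this]
  exact RingHom.ker_isPrime _

theorem secant5_codim_two (k : Type*) [Field k] [IsAlgClosed k] [CharZero k] :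
    ringKrullDim (MvPolynomial (Fin 5 → Fin 2) k ⧸ vanishingIdealX k) = 30 := by
  have := isPrime_vanishingIdealX k
  exact ringKrullDim_eq_of_trdeg_eq k _ (trdeg_quotient_vanishingIdealX k)
end

section
/- The vanishing ideal I(X) contains no nonzero polynomial of degree at most 5: if f ∈ R is homogeneous of degree d ≤ 5 and f vanishes at every tensor of rank at most 5, then f = 0. -/
open MvPolynomial

section Rank

variable {k : Type*} [Field k]

theorem HasRankLE.zero (r : ℕ) : HasRankLE k r 0 :=
  ⟨0, fun I => by simp⟩

theorem HasRankLE.add {r s : ℕ} {p q : (Fin 5 → Fin 2) → k}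
    (hp : HasRankLE k r p) (hq : HasRankLE k s q) : HasRankLE k (r + s) (p + q) := by
  obtain ⟨a, ha⟩ := hp
  obtain ⟨b, hb⟩ := hq
  exact ⟨Fin.append a b, fun I => by simp [Fin.sum_univ_add, ha, hb]⟩

theorem HasRankLE.mono {r s : ℕ} (hrs : r ≤ s) {p : (Fin 5 → Fin 2) → k}
    (hp : HasRankLE k r p) : HasRankLE k s p := by
  obtain ⟨t, rfl⟩ := Nat.exists_eq_add_of_le hrs
  simpa using hp.add (HasRankLE.zero t)

theorem hasRankLE_one_single (I : Fin 5 → Fin 2) (c : k) :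
    HasRankLE k 1 (Pi.single I c) := by
  refine ⟨fun _ i b => (if i = 0 then c else 1) * if b = I i then 1 else 0, fun J => ?_⟩
  simp only [Finset.univ_unique, Finset.sum_singleton, Finset.prod_mul_distrib,
    Finset.prod_ite_eq', Finset.mem_univ, if_true, Finset.prod_ite_zero, Finset.prod_const_one]
  by_cases h : J = I
  · simp [h]
  · simp [h, ← funext_iff]

/-- A tensor supported on a finite set of coordinates has rank at most its cardinality. -/
theorem hasRankLE_sum_single (S : Finset (Fin 5 → Fin 2)) (p : (Fin 5 → Fin 2) → k) :
    HasRankLE k S.card (∑ I ∈ S, Pi.single I (p I)) := by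
  induction S using Finset.induction_on with
  | empty => simpa using HasRankLE.zero 0
  | insert I S hI ih =>
    rw [Finset.sum_insert hI, Finset.card_insert_of_notMem hI, add_comm S.card]
    exact (hasRankLE_one_single I (p I)).add ih

end Rank

/-- Setting to zero the variables outside `S` does not change the coefficients of the monomials
supported in `S`. -/
theorem MvPolynomial.coeff_aeval_ite_mem {σ R : Type*} [DecidableEq σ] [CommSemiring R]
    (S : Finset σ) (f : MvPolynomial σ R) {m : σ →₀ ℕ} (hm : m.support ⊆ S) :
    coeff m (aeval (fun i => if i ∈ S then (X i : MvPolynomial σ R) else 0) f) = coeff m f := by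
  induction f using MvPolynomial.induction_on' with
  | add p q hp hq => rw [map_add, coeff_add, coeff_add, hp, hq]
  | monomial e a =>
    rw [aeval_monomial]
    by_cases he : e.support ⊆ S
    · rw [Finsupp.prod_congr (g2 := fun i n => (X i : MvPolynomial σ R) ^ n)
        fun i hi => by rw [if_pos (he hi)], monomial_eq, algebraMap_eq]
    · obtain ⟨i, hi, hiS⟩ := Finset.not_subset.mp he
      have hne : e ≠ m := by
        rintro rfl
        exact he hm
      rw [Finsupp.prod, Finset.prod_eq_zero hi, mul_zero, coeff_zero, coeff_monomial, if_neg hne]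
      rw [if_neg hiS, zero_pow (Finsupp.mem_support_iff.mp hi)]

theorem no_equations_up_to_degree_five (k : Type*) [Field k] [IsAlgClosed k] [CharZero k]
    (f : MvPolynomial (Fin 5 → Fin 2) k) (d : ℕ) (hf : f.IsHomogeneous d) (hd : d ≤ 5)
    (hv : f ∈ vanishingIdealX k) : f = 0 := by
  ext m
  by_contra hm
  rw [coeff_zero] at hm
  have hcard : m.support.card ≤ 5 := by
    have hdeg : m.degree = d := by
      by_contra h
      exact hm (hf.coeff_eq_zero h)
    refine le_trans ?_ (hdeg.le.trans hd)
    rw [Finsupp.degree_apply, Finset.card_eq_sum_ones]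
    exact Finset.sum_le_sum fun i hi => Nat.one_le_iff_ne_zero.mpr (Finsupp.mem_support_iff.mp hi)
  refine hm ?_
  rw [← coeff_aeval_ite_mem m.support f subset_rfl]
  suffices h : aeval (fun i => if i ∈ m.support then
      (X i : MvPolynomial (Fin 5 → Fin 2) k) else 0) f = 0 by
    rw [h, coeff_zero]
  refine MvPolynomial.funext fun p => ?_
  have hp := hv _ ((hasRankLE_sum_single m.support p).mono hcard)
  rw [map_zero, ← hp, ← aeval_eq_eval, ← aeval_eq_eval, ← AlgHom.comp_apply, comp_aeval]
  congr 2
  funext I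
  by_cases hI : I ∈ m.support <;> simp [hI, Finset.sum_apply, Pi.single_apply]
end
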